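/- (Evidence lower bound and tightness) Let π be a full-support prior policy, Z = Σ_h p_π(h)·exp R(h), and ρ(h) = p_π(h)·exp(R(h)) / Z. Then for every policy q with q_t(s,a) > 0 → π_t(s,a) > 0 one has L(q) ≤ log Z, with equality if and only if the trajectory distribution p_q equals ρ. -/

import Mathlib

/-- Probability of a trajectory `x` (index `i : Fin T` represents time `i+1`, so times run
over `1,…,T`) under initial distribution `p₁`, transition kernel `P` and policy `q`:
`p_q(h) = p₁(s₁) · ∏_{t=1}^T q_t(s_t,a_t) · ∏_{t=2}^T P(s_{t−1},a_{t−1},s_t)`. -/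
noncomputable def pTraj {S A : Type} (T : ℕ) (p₁ : S → ℝ) (P : S → A → S → ℝ)
    (q : ℕ → S → A → ℝ) (x : Fin T → S × A) : ℝ :=
  (if h0 : 0 < T then p₁ (x ⟨0, h0⟩).1 else 1) *
    (∏ i : Fin T, q (i.1 + 1) (x i).1 (x i).2) *
    ∏ i : Fin T, if hlt : i.1 + 1 < T then P (x i).1 (x i).2 (x ⟨i.1 + 1, hlt⟩).1 else 1

/-- Return of a trajectory: `R(h) = ∑_{t=1}^T R(s_t,a_t)`. -/
noncomputable def ret {S A : Type} (T : ℕ) (R : S → A → ℝ) (x : Fin T → S × A) : ℝ :=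
  ∑ i : Fin T, R (x i).1 (x i).2

/-- Value of a policy: `J(q) = ∑_h p_q(h)·R(h)`. -/
noncomputable def Jval {S A : Type} [Fintype S] [Fintype A] (T : ℕ) (p₁ : S → ℝ) (P : S → A → S → ℝ)
    (R : S → A → ℝ) (q : ℕ → S → A → ℝ) : ℝ :=
  ∑ x : Fin T → S × A, pTraj T p₁ P q x * ret T R x

/-- KL-regularized objective of `q` relative to the prior `π`:
`L(q) = ∑_{h : p_q(h)>0} p_q(h)·(R(h) + ∑_{t=1}^T log(π_t(s_t,a_t)/q_t(s_t,a_t)))`. -/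
noncomputable def Lval {S A : Type} [Fintype S] [Fintype A] (T : ℕ) (p₁ : S → ℝ) (P : S → A → S → ℝ)
    (R : S → A → ℝ) (π q : ℕ → S → A → ℝ) : ℝ :=
  ∑ x : Fin T → S × A,
    if 0 < pTraj T p₁ P q x then
      pTraj T p₁ P q x * (ret T R x +
        ∑ i : Fin T,
          Real.log (π (i.1 + 1) (x i).1 (x i).2 / q (i.1 + 1) (x i).1 (x i).2))
    else 0

/-- `q` is a (nonstationary) policy for times `1,…,T`. -/
def IsPolicy {S A : Type} [Fintype A] (T : ℕ) (q : ℕ → S → A → ℝ) : Prop :=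
  ∀ t ∈ Finset.Icc 1 T, ∀ s : S, (∀ a : A, 0 ≤ q t s a) ∧ (∑ a : A, q t s a) = 1

/-- `π` has full support: `π_t(s,a) > 0` for all `t,s,a`. -/
def FullSupport {S A : Type} (T : ℕ) (π : ℕ → S → A → ℝ) : Prop :=
  ∀ t ∈ Finset.Icc 1 T, ∀ (s : S) (a : A), 0 < π t s a

/-- `q` is absolutely continuous w.r.t. `π`: `q_t(s,a) > 0 → π_t(s,a) > 0`. -/
def AbsCont {S A : Type} (T : ℕ) (q π : ℕ → S → A → ℝ) : Prop :=
  ∀ t ∈ Finset.Icc 1 T, ∀ (s : S) (a : A), 0 < q t s a → 0 < π t s a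

/-- KL divergence on a finite type: `KL(u‖v) = ∑_{x : u(x)>0} u(x)·log(u(x)/v(x))`. -/
noncomputable def KL {X : Type} [Fintype X] (u v : X → ℝ) : ℝ :=
  ∑ x : X, if 0 < u x then u x * Real.log (u x / v x) else 0

theorem pTraj_cons {S A : Type} (n : ℕ) (p₁ : S → ℝ) (P : S → A → S → ℝ)
    (q : ℕ → S → A → ℝ) (z : S × A) (x : Fin n → S × A) :
    pTraj (n + 1) p₁ P q (Fin.cons z x) =
      p₁ z.1 * q 1 z.1 z.2 * pTraj n (P z.1 z.2) P (fun t => q (t + 1)) x := by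
  have hhead : (if h : 0 + 1 < n + 1 then
      P z.1 z.2 ((Fin.cons z x : Fin (n + 1) → S × A) ⟨0 + 1, h⟩).1 else 1) =
      if h : 0 < n then P z.1 z.2 (x ⟨0, h⟩).1 else 1 := by
    by_cases h : 0 < n
    · rw [dif_pos h, dif_pos (by omega)]; rfl
    · rw [dif_neg h, dif_neg (by omega)]
  have htail : ∀ i : Fin n, (if h : i.1 + 1 + 1 < n + 1 then
      P (x i).1 (x i).2 ((Fin.cons z x : Fin (n + 1) → S × A) ⟨i.1 + 1 + 1, h⟩).1 else 1) =
      if h : i.1 + 1 < n then P (x i).1 (x i).2 (x ⟨i.1 + 1, h⟩).1 else 1 := by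
    intro i
    by_cases h : i.1 + 1 < n
    · rw [dif_pos h, dif_pos (by omega)]; rfl
    · rw [dif_neg h, dif_neg (by omega)]
  have hzero : (Fin.cons z x : Fin (n + 1) → S × A) ⟨0, n.succ_pos⟩ = z := rfl
  unfold pTraj
  simp only [Fin.prod_univ_succ, Fin.cons_zero, Fin.cons_succ, Fin.val_zero, Fin.val_succ]
  rw [hhead, Finset.prod_congr rfl fun i _ => htail i, dif_pos n.succ_pos, hzero]
  simp only [zero_add]
  ring

theorem IsPolicy.shift {S A : Type} [Fintype A] {n : ℕ} {q : ℕ → S → A → ℝ}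
    (hq : IsPolicy (n + 1) q) : IsPolicy n (fun t => q (t + 1)) := by
  intro t ht
  rw [Finset.mem_Icc] at ht
  exact hq (t + 1) (Finset.mem_Icc.2 ⟨by omega, by omega⟩)

theorem IsPolicy.nonneg {S A : Type} [Fintype A] {T : ℕ} {q : ℕ → S → A → ℝ}
    (hq : IsPolicy T q) (i : Fin T) (s : S) (a : A) : 0 ≤ q (i.1 + 1) s a :=
  (hq (i.1 + 1) (Finset.mem_Icc.2 ⟨by omega, i.2⟩) s).1 a

theorem sum_pTraj {S A : Type} [Fintype S] [Fintype A] (T : ℕ)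
    (p₁ : S → ℝ) (hp₁sum : (∑ s : S, p₁ s) = 1)
    (P : S → A → S → ℝ) (hPsum : ∀ s a, (∑ s' : S, P s a s') = 1)
    (q : ℕ → S → A → ℝ) (hq : IsPolicy T q) :
    ∑ x : Fin T → S × A, pTraj T p₁ P q x = 1 := by
  induction T generalizing p₁ q with
  | zero => simp [pTraj]
  | succ n ih =>
    rw [← (Fin.consEquiv fun _ => S × A).sum_comp, Fintype.sum_prod_type]
    simp only [Fin.consEquiv, Equiv.coe_fn_mk, pTraj_cons]
    simp_rw [← Finset.mul_sum, ih _ (hPsum _ _) _ hq.shift, mul_one]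
    rw [Fintype.sum_prod_type]
    simp_rw [← Finset.mul_sum, (hq 1 (Finset.mem_Icc.2 ⟨le_rfl, by omega⟩) _).2, mul_one]
    exact hp₁sum

theorem pTraj_transition_nonneg {S A : Type} {T : ℕ} {P : S → A → S → ℝ}
    (hP : ∀ s a s', 0 ≤ P s a s') (x : Fin T → S × A) :
    0 ≤ ∏ i : Fin T,
      if hlt : i.1 + 1 < T then P (x i).1 (x i).2 (x ⟨i.1 + 1, hlt⟩).1 else 1 := by
  refine Finset.prod_nonneg fun i _ => ?_
  split_ifs
  exacts [hP _ _ _, zero_le_one]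

theorem pTraj_initial_nonneg {S A : Type} {T : ℕ} {p₁ : S → ℝ} (hp₁ : ∀ s, 0 ≤ p₁ s)
    (x : Fin T → S × A) : 0 ≤ if h0 : 0 < T then p₁ (x ⟨0, h0⟩).1 else 1 := by
  split_ifs
  exacts [hp₁ _, zero_le_one]

theorem pTraj_nonneg {S A : Type} [Fintype A] {T : ℕ}
    {p₁ : S → ℝ} (hp₁ : ∀ s, 0 ≤ p₁ s) {P : S → A → S → ℝ} (hP : ∀ s a s', 0 ≤ P s a s')
    {q : ℕ → S → A → ℝ} (hq : IsPolicy T q) (x : Fin T → S × A) : 0 ≤ pTraj T p₁ P q x :=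
  mul_nonneg (mul_nonneg (pTraj_initial_nonneg hp₁ x)
    (Finset.prod_nonneg fun i _ => hq.nonneg i _ _)) (pTraj_transition_nonneg hP x)

/-- On the support of `p_q`, the prior charges the trajectory and the log-likelihood ratio of the
two trajectory distributions is the sum of the per-step log-ratios of the policies. -/
theorem pTraj_pos_and_log_div {S A : Type} [Fintype A] {T : ℕ}
    {p₁ : S → ℝ} (hp₁ : ∀ s, 0 ≤ p₁ s) {P : S → A → S → ℝ} (hP : ∀ s a s', 0 ≤ P s a s')
    {π q : ℕ → S → A → ℝ} (hq : IsPolicy T q) (hqac : AbsCont T q π)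
    {x : Fin T → S × A} (hx : 0 < pTraj T p₁ P q x) :
    0 < pTraj T p₁ P π x ∧
      Real.log (pTraj T p₁ P π x / pTraj T p₁ P q x) =
        ∑ i : Fin T,
          Real.log (π (i.1 + 1) (x i).1 (x i).2 / q (i.1 + 1) (x i).1 (x i).2) := by
  have hc := pTraj_initial_nonneg hp₁ x
  have hd := pTraj_transition_nonneg hP x
  unfold pTraj at hx ⊢
  set c := if h0 : 0 < T then p₁ (x ⟨0, h0⟩).1 else 1
  set d := ∏ i : Fin T,
    if hlt : i.1 + 1 < T then P (x i).1 (x i).2 (x ⟨i.1 + 1, hlt⟩).1 else 1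
  have hne := hx.ne'
  simp only [mul_ne_zero_iff, Finset.prod_ne_zero_iff, Finset.mem_univ, true_imp_iff] at hne
  obtain ⟨⟨hc0, hq0⟩, hd0⟩ := hne
  have hqpos : ∀ i : Fin T, 0 < q (i.1 + 1) (x i).1 (x i).2 := fun i =>
    lt_of_le_of_ne (hq.nonneg i _ _) (hq0 i).symm
  have hπpos : ∀ i : Fin T, 0 < π (i.1 + 1) (x i).1 (x i).2 := fun i =>
    hqac _ (Finset.mem_Icc.2 ⟨by omega, i.2⟩) _ _ (hqpos i)
  refine ⟨mul_pos (mul_pos (hc.lt_of_ne' hc0) (Finset.prod_pos fun i _ => hπpos i))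
    (hd.lt_of_ne' hd0), ?_⟩
  rw [mul_div_mul_right _ _ hd0, mul_div_mul_left _ _ hc0, ← Finset.prod_div_distrib,
    Real.log_prod fun i _ => (div_pos (hπpos i) (hqpos i)).ne']

/-- Gibbs' inequality for a probability vector `u` against an unnormalised weight `w`, with the
equality case. -/
theorem sum_mul_log_div_le_log_sum {X : Type} [Fintype X] {u w : X → ℝ}
    (hu : ∀ x, 0 ≤ u x) (hw : ∀ x, 0 ≤ w x) (husum : ∑ x, u x = 1)
    (huw : ∀ x, 0 < u x → 0 < w x) :
    (∑ x, if 0 < u x then u x * Real.log (w x / u x) else 0) ≤ Real.log (∑ x, w x) ∧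
      ((∑ x, if 0 < u x then u x * Real.log (w x / u x) else 0) = Real.log (∑ x, w x) ↔
        u = fun x => w x / ∑ y, w y) := by
  obtain ⟨x₀, -, hx₀⟩ : ∃ x ∈ Finset.univ, 0 < u x :=
    Finset.exists_lt_of_sum_lt (f := fun _ => (0 : ℝ)) (by simp [husum])
  have hZ : 0 < ∑ x, w x :=
    Finset.sum_pos' (fun x _ => hw x) ⟨x₀, Finset.mem_univ _, huw x₀ hx₀⟩
  set Z := ∑ x, w x with hZdef
  have key : ∀ x, (if 0 < u x then u x * Real.log (w x / u x) else 0) ≤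
        u x * Real.log Z + (w x / Z - u x) ∧
      ((if 0 < u x then u x * Real.log (w x / u x) else 0) =
        u x * Real.log Z + (w x / Z - u x) ↔ u x = w x / Z) := by
    intro x
    split_ifs with hx
    · have hwx := huw x hx
      have hr : 0 < w x / Z / u x := by positivity
      have hlog : Real.log (w x / u x) = Real.log (w x / Z / u x) + Real.log Z := by
        rw [← Real.log_mul hr.ne' hZ.ne']
        congr 1
        field_simp
      have hsub : w x / Z - u x = u x * (w x / Z / u x - 1) := by field_simp
      rw [hlog, hsub, mul_add, add_comm (u x * Real.log _)]
      refine ⟨?_, ?_⟩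
      · gcongr
        exact Real.log_le_sub_one_of_pos hr
      · rw [add_right_inj, mul_right_inj' hx.ne']
        constructor
        · intro h
          by_contra hne
          refine (Real.log_lt_sub_one_of_pos hr fun h1 => hne ?_).ne h
          exact ((div_eq_one_iff_eq hx.ne').1 h1).symm
        · intro h
          rw [← h, div_self hx.ne']
          simp
    · have h0 : u x = 0 := le_antisymm (not_lt.1 hx) (hu x)
      have := div_nonneg (hw x) hZ.le
      simp [h0, this]
  have hsum : ∑ x, (u x * Real.log Z + (w x / Z - u x)) = Real.log Z := by
    rw [Finset.sum_add_distrib, Finset.sum_sub_distrib, ← Finset.sum_mul, ← Finset.sum_div,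
      husum, ← hZdef, div_self hZ.ne']
    ring
  constructor
  · rw [← hsum]
    exact Finset.sum_le_sum fun x _ => (key x).1
  · conv_lhs => rw [← hsum]
    rw [Finset.sum_eq_sum_iff_of_le fun x _ => (key x).1, funext_iff]
    simp [fun x => (key x).2]

/-- Evidence lower bound and tightness: for every policy `q` absolutely
continuous w.r.t. the full-support prior `π`, `L(q) ≤ log Z`, with equality iff the trajectory
distribution `p_q` equals the posterior trajectory distribution `ρ`. -/
theorem stmt_8 {S A : Type} [Fintype S] [Fintype A] [Nonempty S] [Nonempty A]
    (T : ℕ) (hT : 1 ≤ T)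
    (p₁ : S → ℝ) (hp₁ : ∀ s, 0 ≤ p₁ s) (hp₁sum : (∑ s : S, p₁ s) = 1)
    (P : S → A → S → ℝ) (hP : ∀ s a s', 0 ≤ P s a s')
    (hPsum : ∀ s a, (∑ s' : S, P s a s') = 1)
    (R : S → A → ℝ)
    (π : ℕ → S → A → ℝ) (hπ : IsPolicy T π) (hπpos : FullSupport T π)
    (q : ℕ → S → A → ℝ) (hq : IsPolicy T q) (hqac : AbsCont T q π) :
    let Z : ℝ := ∑ x : Fin T → S × A, pTraj T p₁ P π x * Real.exp (ret T R x)
    let ρ : (Fin T → S × A) → ℝ := fun x => pTraj T p₁ P π x * Real.exp (ret T R x) / Z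
    Lval T p₁ P R π q ≤ Real.log Z ∧
      (Lval T p₁ P R π q = Real.log Z ↔ pTraj T p₁ P q = ρ) := by
  intro Z ρ
  have hL : Lval T p₁ P R π q = ∑ x : Fin T → S × A, if 0 < pTraj T p₁ P q x then
      pTraj T p₁ P q x * Real.log
        (pTraj T p₁ P π x * Real.exp (ret T R x) / pTraj T p₁ P q x) else 0 := by
    refine Finset.sum_congr rfl fun x _ => ?_
    split_ifs with hx
    · obtain ⟨hpos, hlog⟩ := pTraj_pos_and_log_div hp₁ hP hq hqac hx
      rw [← hlog, mul_div_right_comm, Real.log_mul (div_pos hpos hx).ne' (Real.exp_pos _).ne',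
        Real.log_exp, add_comm]
    · rfl
  rw [hL]
  exact sum_mul_log_div_le_log_sum (pTraj_nonneg hp₁ hP hq)
    (fun x => mul_nonneg (pTraj_nonneg hp₁ hP hπ x) (Real.exp_pos _).le)
    (sum_pTraj T p₁ hp₁sum P hPsum q hq)
    (fun x hx => mul_pos (pTraj_pos_and_log_div hp₁ hP hq hqac hx).1 (Real.exp_pos _))
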